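/- Let p be an odd prime. Let N = #{(t,y_1,y_2,y_4,y_5) ∈ F_p^5 : t^2 = −y_1·y_2·(y_1−1)·(y_1+y_2)·(y_2+1)·y_4·y_5·(1+y_4)·(y_4+y_5)·(y_5−1)}. Then N = p^4 + (2p − a_{-1,p}^2)^2 if p ≡ 1 (mod 4), and N = p^4 if p ≡ 3 (mod 4). -/

import Mathlib

section helpers
open Finset

variable {F : Type*} [Field F] [Fintype F] [DecidableEq F]

local notation "χ" => quadraticChar F

lemma hp_sum_sq (hF : ringChar F ≠ 2) (g : F → ℤ) :
    ∑ x : F, g (x ^ 2) = ∑ u : F, g u * (1 + χ u) := by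
  rw [← Finset.sum_fiberwise univ (fun x : F => x ^ 2)]
  refine Finset.sum_congr rfl fun u _ => ?_
  have h := quadraticChar_card_sqrts hF u
  have e : (univ.filter fun x : F => x ^ 2 = u) = {x : F | x ^ 2 = u}.toFinset := by
    ext; simp
  rw [Finset.sum_congr rfl (g := fun _ => g u)
    (fun x hx => by rw [(Finset.mem_filter.mp hx).2]), Finset.sum_const, nsmul_eq_mul, e, h]
  ring

lemma hp_two (hF : ringChar F ≠ 2) : (2 : F) ≠ 0 := Ring.two_ne_zero hF

lemma hp_four (hF : ringChar F ≠ 2) : (4 : F) ≠ 0 := by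
  have := mul_ne_zero (hp_two hF) (hp_two hF)
  norm_num at this; exact this

lemma hp_group (hF : ringChar F ≠ 2) (b : F) (hb : b ≠ 0) (g : F → ℤ) :
    ∑ x ∈ univ.erase (0 : F), g (x + b / x) = ∑ w : F, g w * (1 + χ (w ^ 2 - 4 * b)) := by
  rw [← Finset.sum_fiberwise (univ.erase (0 : F)) (fun x : F => x + b / x)]
  refine Finset.sum_congr rfl fun w _ => ?_
  have h := quadraticChar_card_sqrts hF (w ^ 2 - 4 * b)
  have h2 := hp_two hF
  have h4 := hp_four hF
  have e : #((univ.erase (0 : F)).filter fun x : F => x + b / x = w)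
      = #({x : F | x ^ 2 = w ^ 2 - 4 * b}.toFinset) := by
    refine Finset.card_bij (fun x _ => 2 * x - w) ?_ ?_ ?_
    · intro x hx
      simp only [mem_filter, mem_erase, mem_univ, and_true] at hx
      obtain ⟨hx0, hx⟩ := hx
      simp only [Set.mem_toFinset, Set.mem_setOf_eq]
      have : b = w * x - x ^ 2 := by
        rw [← hx]; field_simp; ring
      rw [this]; ring
    · intro x _ y _ hxy
      have : 2 * x = 2 * y := by linear_combination hxy
      exact mul_left_cancel₀ h2 this
    · intro y hy
      simp only [Set.mem_toFinset, Set.mem_setOf_eq] at hy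
      have hq : ((y + w) / 2) * (w - (y + w) / 2) = b := by
        apply mul_left_cancel₀ h4
        field_simp
        linear_combination -hy
      have hx0 : (y + w) / 2 ≠ 0 := by
        intro h0; rw [h0] at hq; apply hb; rw [← hq]; ring
      refine ⟨(y + w) / 2, ?_, ?_⟩
      · simp only [mem_filter, mem_erase, mem_univ, and_true]
        refine ⟨hx0, ?_⟩
        rw [← hq, mul_div_cancel_left₀ _ hx0]; ring
      · field_simp; ring
  rw [Finset.sum_congr rfl (g := fun _ => g w)
    (fun x hx => by rw [(Finset.mem_filter.mp hx).2]), Finset.sum_const, nsmul_eq_mul, e, h]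
  ring

lemma hp_sum_zero (hF : ringChar F ≠ 2) : ∑ x : F, χ x = 0 := quadraticChar_sum_zero hF

lemma hp_erase (f : F → ℤ) : ∑ x ∈ univ.erase (0 : F), f x = ∑ x, f x - f 0 := by
  rw [← Finset.add_sum_erase univ f (mem_univ 0)]; ring

lemma hp_sq {t : F} (ht : t ≠ 0) : χ t * χ t = 1 := by
  rw [← map_mul, ← sq]; exact quadraticChar_sq_one' ht

lemma hp_affine (c d : F) (hc : c ≠ 0) (g : F → ℤ) : ∑ x, g (c * x + d) = ∑ x, g x := by
  apply Fintype.sum_equiv ((Equiv.mulLeft₀ c hc).trans (Equiv.addRight d))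
  intro x; simp

lemma hp_involution (x : F) (hx : x ≠ 0) (g : F → ℤ) :
    ∑ y ∈ univ.erase (0 : F), g y = ∑ t ∈ univ.erase (0 : F), g (x / t) := by
  refine Finset.sum_bij' (fun y _ => x / y) (fun y _ => x / y) ?_ ?_ ?_ ?_ ?_
  · intro y hy; simp only [mem_erase, mem_univ, and_true] at *; exact div_ne_zero hx hy
  · intro y hy; simp only [mem_erase, mem_univ, and_true] at *; exact div_ne_zero hx hy
  · intro y hy; simp only [mem_erase, mem_univ, and_true] at hy; field_simp
  · intro y hy; simp only [mem_erase, mem_univ, and_true] at hy; field_simp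
  · intro y hy; simp only [mem_erase, mem_univ, and_true] at hy; congr 1; field_simp

lemma hp_quad (hF : ringChar F ≠ 2) (c : F) :
    ∑ u : F, χ ((u - 1) * (u - c)) = (if c = 1 then (Fintype.card F : ℤ) else 0) - 1 := by
  rw [← hp_affine 1 c one_ne_zero (fun u => χ ((u - 1) * (u - c)))]
  have h0 := hp_erase (fun x => χ ((1 * x + c - 1) * (1 * x + c - c)))
  simp only [add_sub_cancel_right, mul_zero, MulChar.map_zero, sub_zero] at h0 ⊢
  rw [← h0, hp_involution 1 one_ne_zero]
  have : ∀ t ∈ univ.erase (0 : F), χ ((1 * (1 / t) + c - 1) * (1 * (1 / t)))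
      = χ ((c - 1) * t + 1) := by
    intro t ht
    simp only [mem_erase, mem_univ, and_true] at ht
    have e : (1 * (1 / t) + c - 1) * (1 * (1 / t)) = (1 / t) * (1 / t) * ((c - 1) * t + 1) := by
      field_simp; ring
    rw [e, map_mul, map_mul, hp_sq (by simpa using ht), one_mul]
  rw [Finset.sum_congr rfl this, hp_erase]
  split_ifs with h
  · subst h; simp
  · rw [hp_affine (c - 1) 1 (sub_ne_zero.mpr h) (fun x => χ x), hp_sum_zero hF]; simp

/-- the double sum -/
def hpS (F : Type*) [Field F] [Fintype F] [DecidableEq F] : ℤ :=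
  ∑ x : F, ∑ y : F, quadraticChar F (x * y * (x - 1) * (x + y) * (y + 1))

lemma hp_S_neg : hpS F = χ (-1) * hpS F := by
  conv_lhs => rw [hpS, Finset.sum_comm]
  have h1 : (-1 : F) ≠ 0 := neg_ne_zero.mpr one_ne_zero
  rw [hpS, Finset.mul_sum, ← hp_affine (-1) 0 h1]
  refine Finset.sum_congr rfl fun x _ => ?_
  rw [Finset.mul_sum, ← hp_affine (-1) 0 h1]
  refine Finset.sum_congr rfl fun y _ => ?_
  rw [← map_mul]
  congr 1
  ring

lemma hp_split (g h : F → ℤ) (hg : ∑ w, g w = 0) :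
    ∑ w, g w * (1 + h w) = ∑ w, g w * h w := by
  simp only [mul_add, mul_one, Finset.sum_add_distrib, hg, zero_add]

lemma hp_isog (hF : ringChar F ≠ 2) (t : F) (ht : t ≠ 0) :
    χ t * ∑ x : F, χ (x * (x - 1) * (x - t ^ 2))
      = ∑ v : F, χ (v * (v - 4)) * χ (v - 2 - (t + 1 / t)) := by
  have h1 : ∑ x : F, χ (x * (x - 1) * (x - t ^ 2))
      = ∑ x ∈ univ.erase (0 : F), χ (x + t ^ 2 / x - (1 + t ^ 2)) := by
    have h0 := hp_erase (fun x => χ (x * (x - 1) * (x - t ^ 2)))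
    simp only [zero_mul, quadraticChar_zero, sub_zero] at h0
    rw [← h0]
    refine Finset.sum_congr rfl fun x hx => ?_
    simp only [mem_erase, mem_univ, and_true] at hx
    have e : x * (x - 1) * (x - t ^ 2) = x * x * (x + t ^ 2 / x - (1 + t ^ 2)) := by
      field_simp; ring
    rw [e, map_mul, map_mul, hp_sq hx, one_mul]
  rw [h1, hp_group hF (t ^ 2) (pow_ne_zero 2 ht) (fun w => χ (w - (1 + t ^ 2)))]
  have h2 : ∑ w : F, χ (w - (1 + t ^ 2)) = 0 := by
    rw [← hp_sum_zero hF, ← hp_affine 1 (-(1 + t ^ 2)) one_ne_zero (fun x => χ x)]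
    refine Finset.sum_congr rfl fun x _ => ?_
    congr 1; ring
  rw [hp_split _ _ h2,
    ← hp_affine t (-2 * t) ht (fun w => χ (w - (1 + t ^ 2)) * χ (w ^ 2 - 4 * t ^ 2)), Finset.mul_sum]
  refine Finset.sum_congr rfl fun v _ => ?_
  rw [← map_mul, ← map_mul, ← map_mul]
  have e : t * ((t * v + -2 * t - (1 + t ^ 2)) * ((t * v + -2 * t) ^ 2 - 4 * t ^ 2))
     = (t * t) * ((t * t) * (v * (v - 4) * (v - 2 - (t + 1 / t)))) := by
    field_simp; ring
  rw [e, map_mul, map_mul χ (t * t), map_mul, hp_sq ht, one_mul, one_mul]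

lemma hp_T (hF : ringChar F ≠ 2) :
    ∑ t ∈ univ.erase (0 : F), χ t * ∑ x : F, χ (x * (x - 1) * (x - t ^ 2)) = hpS F := by
  have h4 := hp_four hF
  rw [Finset.sum_congr rfl fun t ht => hp_isog hF t (by simpa using ht), Finset.sum_comm, hpS,
    ← hp_affine 4 0 h4]
  refine Finset.sum_congr rfl fun x _ => ?_
  rw [← Finset.mul_sum, hp_group hF 1 one_ne_zero (fun w => χ (4 * x + 0 - 2 - w))]
  have h2 : ∑ w : F, χ (4 * x + 0 - 2 - w) = 0 := by
    rw [← hp_sum_zero hF,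
      ← hp_affine (-1) (4 * x + 0 - 2) (neg_ne_zero.mpr one_ne_zero) (fun x => χ x)]
    refine Finset.sum_congr rfl fun x _ => ?_
    congr 1; ring
  rw [hp_split _ _ h2,
    ← hp_affine (-4) (-2) (neg_ne_zero.mpr h4) (fun w => χ (4 * x + 0 - 2 - w) * χ (w ^ 2 - 4 * 1)),
    Finset.mul_sum]
  refine Finset.sum_congr rfl fun y _ => ?_
  rw [← map_mul, ← map_mul]
  have e : (4 * x + 0) * (4 * x + 0 - 4) * ((4 * x + 0 - 2 - (-4 * y + -2)) * ((-4 * y + -2) ^ 2 - 4 * 1))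
     = (4 * 4) * ((2 * 2) * ((4 * 4) * (x * y * (x - 1) * (x + y) * (y + 1)))) := by ring
  rw [e, map_mul, map_mul χ (2 * 2), map_mul χ (4 * 4), map_mul, map_mul χ 2, hp_sq h4,
    hp_sq (hp_two hF)]
  ring

lemma hp_asq (hF : ringChar F ≠ 2) (hm : χ (-1) = 1) :
    (∑ x : F, χ (x ^ 3 - x)) ^ 2 = 2 * (Fintype.card F : ℤ) + hpS F := by
  have h0 := hp_erase (fun x => χ (x ^ 3 - x))
  have e0 : (0 : F) ^ 3 - 0 = 0 := by ring
  simp only [e0, quadraticChar_zero, sub_zero] at h0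
  have h1 : (∑ x : F, χ (x ^ 3 - x)) ^ 2 = ∑ x ∈ univ.erase (0 : F), ∑ t ∈ univ.erase (0 : F),
      χ t * χ ((x ^ 2 - 1) * (x ^ 2 - t ^ 2)) := by
    rw [← h0, sq, Finset.sum_mul]
    refine Finset.sum_congr rfl fun x hx => ?_
    simp only [mem_erase, mem_univ, and_true] at hx
    rw [hp_involution x hx, Finset.mul_sum]
    refine Finset.sum_congr rfl fun t ht => ?_
    simp only [mem_erase, mem_univ, and_true] at ht
    rw [← map_mul, ← map_mul]
    have e : (x ^ 3 - x) * ((x / t) ^ 3 - x / t)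
      = (x / (t * t)) * (x / (t * t)) * (t * ((x ^ 2 - 1) * (x ^ 2 - t ^ 2))) := by
      field_simp
    rw [e, map_mul, map_mul, hp_sq (div_ne_zero hx (mul_ne_zero ht ht)), one_mul]
  have h2 : ∀ t ∈ univ.erase (0 : F),
      ∑ x ∈ univ.erase (0 : F), χ t * χ ((x ^ 2 - 1) * (x ^ 2 - t ^ 2))
      = χ t * (if t ^ 2 = 1 then (Fintype.card F : ℤ) else 0) - 2 * χ t
        + χ t * ∑ x : F, χ (x * (x - 1) * (x - t ^ 2)) := by
    intro t ht
    simp only [mem_erase, mem_univ, and_true] at ht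
    rw [← Finset.mul_sum, hp_erase (fun x => χ ((x ^ 2 - 1) * (x ^ 2 - t ^ 2))),
      hp_sum_sq hF (fun u => χ ((u - 1) * (u - t ^ 2)))]
    have e1 : ((0 : F) ^ 2 - 1) * (0 ^ 2 - t ^ 2) = t * t := by ring
    simp only [mul_add, mul_one, Finset.sum_add_distrib]
    rw [hp_quad hF, e1, map_mul, hp_sq ht]
    have e2 : ∀ x : F, χ ((x - 1) * (x - t ^ 2)) * χ x = χ (x * (x - 1) * (x - t ^ 2)) := by
      intro x; rw [← map_mul]; congr 1; ring
    simp only [e2]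
    ring
  rw [h1, Finset.sum_comm, Finset.sum_congr rfl h2, Finset.sum_add_distrib, hp_T hF,
    Finset.sum_sub_distrib, ← Finset.mul_sum, hp_erase (fun x => χ x), hp_sum_zero hF]
  have h3 : ∑ t ∈ univ.erase (0 : F), χ t * (if t ^ 2 = 1 then (Fintype.card F : ℤ) else 0)
      = 2 * (Fintype.card F : ℤ) := by
    have hne : (1 : F) ≠ -1 := fun h => hp_two hF (by linear_combination h)
    have : ∑ t ∈ ({1, -1} : Finset F), χ t * (if t ^ 2 = 1 then (Fintype.card F : ℤ) else 0)
      = ∑ t ∈ univ.erase (0 : F), χ t * (if t ^ 2 = 1 then (Fintype.card F : ℤ) else 0) := by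
      apply Finset.sum_subset
      · intro t ht
        simp only [mem_insert, mem_singleton] at ht
        rcases ht with rfl | rfl <;> simp
      · intro t _ ht
        simp only [mem_insert, mem_singleton] at ht
        rw [if_neg (fun h => ht (by simpa using h)), mul_zero]
    rw [← this, Finset.sum_pair hne, hm]
    simp; ring
  rw [h3]; simp

lemma hp_card (hF : ringChar F ≠ 2) {α : Type*} [Fintype α] (f : α → F) :
    (Nat.card {v : F × α // v.1 ^ 2 = f v.2} : ℤ) = Fintype.card α + ∑ x, χ (f x) := by
  classical
  have e : {v : F × α // v.1 ^ 2 = f v.2} ≃ Σ x : α, {t : F // t ^ 2 = f x} :=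
    { toFun := fun v => ⟨v.1.2, v.1.1, v.2⟩
      invFun := fun s => ⟨(s.2.1, s.1), s.2.2⟩
      left_inv := fun _ => rfl
      right_inv := fun _ => rfl }
  rw [Nat.card_congr e, Nat.card_eq_fintype_card, Fintype.card_sigma]
  push_cast
  have h : ∀ x, (Fintype.card {t : F // t ^ 2 = f x} : ℤ) = 1 + χ (f x) := by
    intro x
    have := quadraticChar_card_sqrts hF (f x)
    rw [Set.toFinset_card] at this
    rw [add_comm, ← this]
    rfl
  simp [h, Finset.sum_add_distrib]

end helpers


/-- second part of Proposition 3.14 of the paper.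
Let `p` be an odd prime and `a = p − #{(x,y) : y² = x³ − x}`.  Let `N` be the number of
`(t,y₁,y₂,y₄,y₅) ∈ F_p⁵` with
`t² = −y₁·y₂·(y₁−1)·(y₁+y₂)·(y₂+1)·y₄·y₅·(1+y₄)·(y₄+y₅)·(y₅−1)`.  Then
`N = p⁴ + (2p − a²)²` if `p ≡ 1 (mod 4)`, and `N = p⁴` if `p ≡ 3 (mod 4)`. -/
theorem statement6 (p : ℕ) [Fact p.Prime] (hodd : Odd p)
    (a : ℤ)
    (ha : a = p - Nat.card {xy : ZMod p × ZMod p // xy.2 ^ 2 = xy.1 ^ 3 - xy.1})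
    (N : ℕ)
    (hN : N = Nat.card {v : ZMod p × ZMod p × ZMod p × ZMod p × ZMod p //
      v.1 ^ 2 = -(v.2.1 * v.2.2.1 * (v.2.1 - 1) * (v.2.1 + v.2.2.1) * (v.2.2.1 + 1) *
        v.2.2.2.1 * v.2.2.2.2 * (1 + v.2.2.2.1) * (v.2.2.2.1 + v.2.2.2.2) *
        (v.2.2.2.2 - 1))}) :
    (p % 4 = 1 → (N : ℤ) = p ^ 4 + (2 * p - a ^ 2) ^ 2) ∧
    (p % 4 = 3 → (N : ℤ) = p ^ 4) := by
  have hp2 : p ≠ 2 := by rintro rfl; exact absurd hodd (by decide)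
  have hF : ringChar (ZMod p) ≠ 2 := by rwa [ZMod.ringChar_zmod_n]
  have hA : a = -∑ x : ZMod p, quadraticChar (ZMod p) (x ^ 3 - x) := by
    have h := hp_card hF (fun x : ZMod p => x ^ 3 - x)
    have e : Nat.card {xy : ZMod p × ZMod p // xy.2 ^ 2 = xy.1 ^ 3 - xy.1}
        = Nat.card {v : ZMod p × ZMod p // v.1 ^ 2 = v.2 ^ 3 - v.2} :=
      Nat.card_congr ((Equiv.prodComm _ _).subtypeEquiv (fun _ => Iff.rfl))
    rw [ha, e, h, ZMod.card]; ring
  have hS : (N : ℤ) = p ^ 4 + quadraticChar (ZMod p) (-1) * hpS (ZMod p) ^ 2 := by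
    have h := hp_card hF (fun v : ZMod p × ZMod p × ZMod p × ZMod p =>
      -(v.1 * v.2.1 * (v.1 - 1) * (v.1 + v.2.1) * (v.2.1 + 1) *
        v.2.2.1 * v.2.2.2 * (1 + v.2.2.1) * (v.2.2.1 + v.2.2.2) * (v.2.2.2 - 1)))
    rw [hN, h]
    simp only [Fintype.card_prod, ZMod.card, Fintype.sum_prod_type]
    have e1 : hpS (ZMod p) = ∑ z : ZMod p, ∑ w : ZMod p,
        quadraticChar (ZMod p) (w * z * (w - 1) * (w + z) * (z + 1)) := by
      rw [hpS, Finset.sum_comm]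
    have e2 : quadraticChar (ZMod p) (-1) * hpS (ZMod p) ^ 2 = ∑ x : ZMod p, ∑ y : ZMod p,
        ∑ z : ZMod p, ∑ w : ZMod p, quadraticChar (ZMod p) (-(x * y * (x - 1) * (x + y) * (y + 1) *
        z * w * (1 + z) * (z + w) * (w - 1))) := by
      rw [sq]
      nth_rw 2 [e1]
      rw [hpS, Finset.sum_mul, Finset.mul_sum]
      refine Finset.sum_congr rfl fun x _ => ?_
      rw [Finset.sum_mul, Finset.mul_sum]
      refine Finset.sum_congr rfl fun y _ => ?_
      rw [Finset.mul_sum, Finset.mul_sum]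
      refine Finset.sum_congr rfl fun z _ => ?_
      rw [Finset.mul_sum, Finset.mul_sum]
      refine Finset.sum_congr rfl fun w _ => ?_
      rw [← map_mul, ← map_mul]
      congr 1; ring
    rw [e2]; push_cast; ring
  have hm : quadraticChar (ZMod p) (-1) = ZMod.χ₄ p := by
    rw [quadraticChar_neg_one hF, ZMod.card]
  constructor
  · intro h1
    have h : quadraticChar (ZMod p) (-1) = 1 := by rw [hm, ZMod.χ₄_nat_one_mod_four h1]
    have := hp_asq hF h
    rw [ZMod.card] at this
    rw [hS, h, hA, neg_sq, this]; ring
  · intro h3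
    have h : quadraticChar (ZMod p) (-1) = -1 := by rw [hm, ZMod.χ₄_nat_three_mod_four h3]
    have h0 := hp_S_neg (F := ZMod p)
    rw [h] at h0
    have : hpS (ZMod p) = 0 := by linarith
    rw [hS, this]; ring
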